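/- The clique number of the orthomorphism graph of Z₂ × Z₄ equals 2; that is, there exist two orthogonal normalized orthomorphisms of Z₂ × Z₄, but no three pairwise orthogonal ones. -/

import Mathlib

/-- The group `ℤ₂ × ℤ₄` (written additively). -/
abbrev G24 : Type := ZMod 2 × ZMod 4

/-- A normalized orthomorphism: a bijection fixing the identity whose associated
complete mapping `x ↦ -x + θ x` (i.e. `x⁻¹θ(x)` in additive notation) is a bijection. -/
def IsNormOrtho (θ : G24 → G24) : Prop :=
  Function.Bijective θ ∧ θ 0 = 0 ∧ Function.Bijective (fun x => -x + θ x)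

/-- Orthogonality of orthomorphisms: `x ↦ θ₁(x)⁻¹θ₂(x)` is a bijection. -/
def Orthogonal (θ₁ θ₂ : G24 → G24) : Prop :=
  Function.Bijective (fun x => -θ₁ x + θ₂ x)

/-- `A i j θ = {x : order of x is i and order of θ(x) is j}`. -/
def A (i j : ℕ) (θ : G24 → G24) : Set G24 :=
  {x | addOrderOf x = i ∧ addOrderOf (θ x) = j}

theorem natBeq_false (a b : ℕ) : Nat.beq a b = false ↔ ¬ a = b := by
  rw [← Nat.beq_eq, Bool.not_eq_true]

/-- Code of a group element as a number below 8. -/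
def enc (x : G24) : ℕ := 4 * x.1.val + x.2.val

/-- Inverse of `enc`. -/
def dec (n : ℕ) : G24 := ((n / 4 : ℕ), (n % 4 : ℕ))

/-- `-x + y` on codes. -/
def csub (x y : ℕ) : ℕ := 4 * ((x / 4 + y / 4) % 2) + (y % 4 + 4 - x % 4) % 4

theorem enc_inj : Function.Injective enc := by unfold Function.Injective enc; decide

theorem enc_lt : ∀ x, enc x < 8 := by unfold enc; decide

theorem enc_sub : ∀ x y : G24, enc (-x + y) = csub (enc x) (enc y) := by
  unfold enc csub; decide +kernel

theorem enc_dec : ∀ i < 8, enc (dec i) = i := by unfold enc dec; decide +kernel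

theorem enc_zero : enc 0 = 0 := by decide

/-- May the value `y` at position `k` be added to the partial orthomorphism `l`? -/
def chk (k y : ℕ) (l : List (ℕ × ℕ)) : Bool :=
  l.all fun p => !(Nat.beq y p.2) && !(Nat.beq (csub k y) (csub p.1 p.2))

/-- All partial normalized orthomorphisms on codes `0, …, k`. -/
def search : ℕ → List (List (ℕ × ℕ))
  | 0 => [[(0, 0)]]
  | k + 1 => (search k).flatMap fun l =>
      (([0, 1, 2, 3, 4, 5, 6, 7].filter fun y => chk (k + 1) y l).map fun y => (k + 1, y) :: l)

/-- The table of `f` on `0, …, k - 1`. -/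
def lst (f : ℕ → ℕ) : ℕ → List (ℕ × ℕ)
  | 0 => []
  | k + 1 => (k, f k) :: lst f k

theorem mem_lst (f : ℕ → ℕ) (k : ℕ) (p : ℕ × ℕ) (h : p ∈ lst f k) :
    p.1 < k ∧ p.2 = f p.1 := by
  induction k with
  | zero => simp [lst] at h
  | succ k ih =>
    simp only [lst, List.mem_cons] at h
    rcases h with rfl | h
    · simp
    · exact ⟨(ih h).1.trans (Nat.lt_succ_self k), (ih h).2⟩

/-- Boolean test that a list of numbers has no repetition. -/
def nodupB : List ℕ → Bool
  | [] => true
  | x :: l => (l.all fun y => !(Nat.beq x y)) && nodupB l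

/-- Boolean orthogonality test for tables. -/
def orthB (l m : List (ℕ × ℕ)) : Bool :=
  nodupB (List.zipWith (fun p q => csub p.2 q.2) l m)

/-- The code version of a map. -/
def cmap (θ : G24 → G24) (i : ℕ) : ℕ := enc (θ (dec i))

theorem dec_inj {i j : ℕ} (hi : i < 8) (hj : j < 8) (h : dec i = dec j) : i = j := by
  rw [← enc_dec i hi, ← enc_dec j hj, h]

theorem mem_search (θ : G24 → G24) (h : IsNormOrtho θ) (k : ℕ) (hk : k < 8) :
    lst (cmap θ) (k + 1) ∈ search k := by
  obtain ⟨hb, h0, hc⟩ := h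
  induction k with
  | zero =>
    have : dec 0 = 0 := by decide
    simp [lst, search, cmap, this, h0, enc_zero]
  | succ k ih =>
    simp only [search, List.mem_flatMap, List.mem_map, List.mem_filter]
    refine ⟨_, ih (by omega), cmap θ (k + 1), ⟨?_, ?_⟩, rfl⟩
    · have : cmap θ (k + 1) < 8 := enc_lt _
      interval_cases cmap θ (k + 1) <;> simp
    · simp only [chk, List.all_eq_true, Bool.and_eq_true, Bool.not_eq_true', natBeq_false]
      intro p hp
      obtain ⟨hp1, hp2⟩ := mem_lst _ _ _ hp
      rw [hp2]
      refine ⟨fun e => ?_, fun e => ?_⟩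
      · have := dec_inj hk (by omega) (hb.1 (enc_inj e))
        omega
      · have e2 : enc (-dec (k + 1) + θ (dec (k + 1))) = enc (-dec p.1 + θ (dec p.1)) := by
          rw [enc_sub, enc_sub, enc_dec _ hk, enc_dec _ (by omega)]
          exact e
        have := dec_inj hk (by omega) (hc.1 (enc_inj e2))
        omega

theorem mem_zip (f g : ℕ → ℕ) (k y : ℕ)
    (h : y ∈ List.zipWith (fun p q : ℕ × ℕ => csub p.2 q.2) (lst f k) (lst g k)) :
    ∃ i < k, y = csub (f i) (g i) := by
  induction k with
  | zero => simp [lst] at h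
  | succ k ih =>
    simp only [lst, List.zipWith_cons_cons, List.mem_cons] at h
    rcases h with rfl | h
    · exact ⟨k, by omega, rfl⟩
    · obtain ⟨i, hi, e⟩ := ih h
      exact ⟨i, by omega, e⟩

theorem orthB_of (θ₁ θ₂ : G24 → G24) (h : Orthogonal θ₁ θ₂) (k : ℕ) (hk : k ≤ 8) :
    orthB (lst (cmap θ₁) k) (lst (cmap θ₂) k) = true := by
  induction k with
  | zero => rfl
  | succ k ih =>
    have ih' := ih (by omega)
    simp only [orthB] at ih'
    simp only [orthB, lst, List.zipWith_cons_cons, nodupB, ih', Bool.and_true,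
      List.all_eq_true, Bool.not_eq_true', natBeq_false]
    intro y hy e
    obtain ⟨i, hi, rfl⟩ := mem_zip _ _ _ _ hy
    have e2 : enc (-θ₁ (dec k) + θ₂ (dec k)) = enc (-θ₁ (dec i) + θ₂ (dec i)) := by
      rw [enc_sub, enc_sub]
      exact e
    have := dec_inj (by omega) (by omega) (h.1 (enc_inj e2))
    omega

/-- No element of `L` is orthogonal to two orthogonal elements of `L`. -/
def triangleFree (L : List (List (ℕ × ℕ))) : Bool :=
  L.all fun a => L.all fun b => !(orthB a b) || L.all fun c => !(orthB a c && orthB b c)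

theorem triangleFree_search : triangleFree (search 7) = true := by decide +kernel

/-- The clique number of the orthomorphism graph of `ℤ₂ × ℤ₄` is 2. -/
theorem clique_number_two :
    (∃ θ₁ θ₂ : G24 → G24, IsNormOrtho θ₁ ∧ IsNormOrtho θ₂ ∧ Orthogonal θ₁ θ₂) ∧
    ¬ ∃ θ₁ θ₂ θ₃ : G24 → G24, IsNormOrtho θ₁ ∧ IsNormOrtho θ₂ ∧ IsNormOrtho θ₃ ∧
        Orthogonal θ₁ θ₂ ∧ Orthogonal θ₂ θ₃ ∧ Orthogonal θ₁ θ₃ := by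
  constructor
  · refine ⟨fun x => dec ([0, 2, 4, 6, 1, 7, 5, 3].getD (enc x) 0),
      fun x => dec ([0, 3, 6, 5, 7, 2, 1, 4].getD (enc x) 0), ?_, ?_, ?_⟩
    · unfold IsNormOrtho; decide +kernel
    · unfold IsNormOrtho; decide +kernel
    · unfold Orthogonal; decide +kernel
  · rintro ⟨θ₁, θ₂, θ₃, h₁, h₂, h₃, h12, h23, h13⟩
    have key := triangleFree_search
    simp only [triangleFree, List.all_eq_true] at key
    have := key _ (mem_search θ₁ h₁ 7 (by omega)) _ (mem_search θ₂ h₂ 7 (by omega))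
    rw [orthB_of θ₁ θ₂ h12 8 le_rfl, Bool.not_true, Bool.false_or, List.all_eq_true] at this
    have := this _ (mem_search θ₃ h₃ 7 (by omega))
    rw [orthB_of θ₁ θ₃ h13 8 le_rfl, orthB_of θ₂ θ₃ h23 8 le_rfl] at this
    exact absurd this (by decide)
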